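/- Let N ≥ 1 be an integer, K : ℝ^d → ℝ compactly supported of class C^N, and f : ℝ^d → ℝ bounded measurable. Then for all h, h' > 0 and every multi-index α ∈ ℕ^d with |α| = N, ‖∂^α (K_{h'} * (K_{h'} * f) - K_h * (K_h * f))‖_∞ ≤ ((h')^{-N} + h^{-N}) · ‖K_{h'} * f - K_h * f‖_∞ · ∫ |∂^α K(t)| dt. -/

import Mathlib

open MeasureTheory Real ENNReal

noncomputable section

/-- The rescaled kernel `K_h(t) = h^{-d} K(t/h)`. -/
def resKer (d : ℕ) (K : EuclideanSpace ℝ (Fin d) → ℝ) (h : ℝ) :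
    EuclideanSpace ℝ (Fin d) → ℝ :=
  fun t => (h ^ d)⁻¹ * K (h⁻¹ • t)

/-- Convolution `(g * f)(t) = ∫ g(t-u) f(u) du` on `ℝ^d`. -/
def convol (d : ℕ) (g f : EuclideanSpace ℝ (Fin d) → ℝ) :
    EuclideanSpace ℝ (Fin d) → ℝ :=
  fun t => ∫ u, g (t - u) * f u

/-- The sup-norm `‖f‖_∞` (essential supremum of `|f|` over `ℝ^d`), with values in `ℝ≥0∞`. -/
def supNorm (d : ℕ) (f : EuclideanSpace ℝ (Fin d) → ℝ) : ℝ≥0∞ :=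
  eLpNorm f ⊤ volume

/-- `f` is 1-periodic: `f(x + e_i) = f(x)` for every standard basis vector `e_i`. -/
def Per1 (d : ℕ) (f : EuclideanSpace ℝ (Fin d) → ℝ) : Prop :=
  ∀ x (i : Fin d), f (x + EuclideanSpace.single i 1) = f x

/-- `f` is bounded and measurable. -/
def BddMeas (d : ℕ) (f : EuclideanSpace ℝ (Fin d) → ℝ) : Prop :=
  Measurable f ∧ ∃ M, ∀ x, |f x| ≤ M

/-- The partial derivative `∂f/∂t_i`. -/
def pderiv1 (d : ℕ) (i : Fin d) (f : EuclideanSpace ℝ (Fin d) → ℝ) :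
    EuclideanSpace ℝ (Fin d) → ℝ :=
  fun x => fderiv ℝ f x (EuclideanSpace.single i 1)

/-- The partial derivative `∂^α f = ∂^{α_1}_{t_1} ⋯ ∂^{α_d}_{t_d} f` for a multi-index `α`. -/
def pderivM (d : ℕ) (α : Fin d → ℕ) (f : EuclideanSpace ℝ (Fin d) → ℝ) :
    EuclideanSpace ℝ (Fin d) → ℝ :=
  (List.finRange d).foldr (fun i g => (pderiv1 d i)^[α i] g) f

/-- The kernel class `K(N)`: conditions (A1)–(A6) of the paper. -/
def KernelClass (d N : ℕ) (K : EuclideanSpace ℝ (Fin d) → ℝ) : Prop :=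
  -- (A1) compact support
  HasCompactSupport K ∧
  -- (A2) square-integrable
  Integrable (fun u => K u ^ 2) ∧
  -- (A3) L² increment bound
  (∃ C > 0, ∃ γ ∈ Set.Ioc (0 : ℝ) 1, ∀ t : EuclideanSpace ℝ (Fin d), ‖t‖ ≤ 1 →
    ∫ u, (K (t + u) - K u) ^ 2 ≤ C * ‖t‖ ^ (2 * γ)) ∧
  -- (A4) unit mass
  (∫ u, K u) = 1 ∧
  -- (A5) smoothness and integrable partial derivatives up to order N
  (ContDiff ℝ N K ∧ ∀ α : Fin d → ℕ, (∑ i, α i) ≤ N →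
    Integrable (fun t => |pderivM d α K t|)) ∧
  -- (A6) vanishing moments
  (∀ α : Fin d → ℕ, 1 ≤ (∑ i, α i) → (∑ i, α i) ≤ N →
    ∫ u, (∏ i, u i ^ α i) * K u = 0)

/-- The bandwidth class `H`: `h_n = 2^{-m_n}` with `(m_n)` nondecreasing positive integers
tending to `∞` and with bounded increments. -/
def BandClass (h : ℕ → ℝ) : Prop :=
  ∃ m : ℕ → ℕ, (∀ n, 0 < m n) ∧ Monotone m ∧
    Filter.Tendsto m Filter.atTop Filter.atTop ∧
    (∃ B : ℕ, ∀ n, m (n + 1) - m n ≤ B) ∧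
    ∀ n, h n = (2 : ℝ) ^ (-(m n : ℝ))

/-- `f` belongs to the Besov space `B^β_{∞,∞}` in the approximation sense: there are bounded
1-periodic `C^N` functions `f_j` with `sup_j 2^{jβ} ‖f - f_j‖_∞ < ∞` and
`sup_j 2^{-(N-β)j} ‖∂^α f_j‖_∞ < ∞` for every multi-index `α` with `|α| = N`. -/
def MemBesov (d : ℕ) (β : ℝ) (N : ℕ) (f : EuclideanSpace ℝ (Fin d) → ℝ) : Prop :=
  ∃ fs : ℕ → EuclideanSpace ℝ (Fin d) → ℝ,
    (∀ j, 1 ≤ j → (∃ M, ∀ x, |fs j x| ≤ M) ∧ Per1 d (fs j) ∧ ContDiff ℝ N (fs j)) ∧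
    (∃ C : ℝ, ∀ j : ℕ, 1 ≤ j →
      supNorm d (fun x => f x - fs j x) ≤ ENNReal.ofReal (C * 2 ^ (-(j : ℝ) * β))) ∧
    (∃ C : ℝ, ∀ α : Fin d → ℕ, (∑ i, α i) = N → ∀ j : ℕ, 1 ≤ j →
      supNorm d (pderivM d α (fs j)) ≤ ENNReal.ofReal (C * 2 ^ (((N : ℝ) - β) * j)))

/-- The Hölder class `Σ(β)`: `f` is a bounded 1-periodic function of class `C^m`
(`m` the largest integer strictly less than `β`) all of whose partial derivatives of order `m`
are `(β-m)`-Hölder. -/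
def HolderSigma (d : ℕ) (β : ℝ) (f : EuclideanSpace ℝ (Fin d) → ℝ) : Prop :=
  ∃ m : ℕ, (m : ℝ) < β ∧ β ≤ (m : ℝ) + 1 ∧
    ContDiff ℝ m f ∧ (∃ M, ∀ x, |f x| ≤ M) ∧ Per1 d f ∧
    ∀ σ : Fin d → ℕ, (∑ i, σ i) = m → ∃ C : ℝ, ∀ x y,
      |pderivM d σ f x - pderivM d σ f y| ≤ C * ‖x - y‖ ^ (β - (m : ℝ))

end

open ContinuousLinearMap in
lemma convol_eq_convolution (d : ℕ) (g f : EuclideanSpace ℝ (Fin d) → ℝ) :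
    convol d g f = convolution f g (mul ℝ ℝ) volume := by
  ext t
  simp only [convol, convolution_def, mul_apply', mul_comm]

/-- Induction principle for `pderivM`: a relation that is preserved by every first order partial
derivative, at the price of one unit of the index, is preserved by `∂^α` at the price of `|α|`. -/
lemma pderivM_induction (d : ℕ)
    (P : ℕ → (EuclideanSpace ℝ (Fin d) → ℝ) → (EuclideanSpace ℝ (Fin d) → ℝ) → Prop)
    (hP : ∀ n i g G, P (n + 1) g G → P n (pderiv1 d i g) (pderiv1 d i G))
    (α : Fin d → ℕ) (g G : EuclideanSpace ℝ (Fin d) → ℝ) (h : P (∑ i, α i) g G) :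
    P 0 (pderivM d α g) (pderivM d α G) := by
  have iter : ∀ (i : Fin d) (k n : ℕ) (u v), P (n + k) u v →
      P n ((pderiv1 d i)^[k] u) ((pderiv1 d i)^[k] v) := by
    intro i k
    induction k with
    | zero => intro n u v huv; exact huv
    | succ k ih =>
      intro n u v huv
      exact ih n _ _ (hP _ i u v huv)
  have fold : ∀ (l : List (Fin d)) (n : ℕ), P (n + (l.map α).sum) g G →
      P n (l.foldr (fun i g => (pderiv1 d i)^[α i] g) g)
        (l.foldr (fun i g => (pderiv1 d i)^[α i] g) G) := by
    intro l
    induction l with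
    | nil => intro n hn; simpa using hn
    | cons i l ih =>
      intro n hn
      refine iter i (α i) n _ _ (ih (n + α i) ?_)
      rwa [List.map_cons, List.sum_cons, ← add_assoc] at hn
  refine fold (List.finRange d) 0 ?_
  rwa [zero_add, ← Fin.sum_univ_def]

lemma ContDiff.pderiv1 {d n : ℕ} {g : EuclideanSpace ℝ (Fin d) → ℝ}
    (hg : ContDiff ℝ (n + 1 : ℕ) g) (i : Fin d) : ContDiff ℝ n (pderiv1 d i g) :=
  (hg.fderiv_right (m := n) (by push_cast; exact le_rfl)).clm_apply contDiff_const

lemma HasCompactSupport.pderiv1 {d : ℕ} {g : EuclideanSpace ℝ (Fin d) → ℝ}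
    (hg : HasCompactSupport g) (i : Fin d) : HasCompactSupport (pderiv1 d i g) :=
  hg.fderiv_apply (𝕜 := ℝ) (EuclideanSpace.single i 1)

lemma ContDiff.resKer {d n : ℕ} {g : EuclideanSpace ℝ (Fin d) → ℝ} (hg : ContDiff ℝ n g) (h : ℝ) :
    ContDiff ℝ n (resKer d g h) :=
  contDiff_const.mul (hg.comp (contDiff_const_smul _))

lemma HasCompactSupport.resKer {d : ℕ} {g : EuclideanSpace ℝ (Fin d) → ℝ}
    (hg : HasCompactSupport g) {h : ℝ} (hh : h ≠ 0) : HasCompactSupport (resKer d g h) :=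
  (hg.comp_smul (inv_ne_zero hh)).mul_left (f := fun _ => (h ^ d)⁻¹)

lemma pderiv1_resKer (d : ℕ) (i : Fin d) (g : EuclideanSpace ℝ (Fin d) → ℝ) (h : ℝ) :
    pderiv1 d i (resKer d g h) = fun t => h⁻¹ * resKer d (pderiv1 d i g) h t := by
  ext t
  have hs : resKer d g h = (h ^ d)⁻¹ • (fun t => g (h⁻¹ • t)) := rfl
  simp only [hs, pderiv1, fderiv_const_smul_field, Pi.smul_apply, fderiv_comp_smul,
    _root_.smul_apply, smul_eq_mul, resKer]
  ring

lemma pderiv1_convol {d : ℕ} (i : Fin d) {g f : EuclideanSpace ℝ (Fin d) → ℝ}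
    (hg : ContDiff ℝ 1 g) (hgs : HasCompactSupport g) (hf : LocallyIntegrable f) :
    pderiv1 d i (convol d g f) = convol d (pderiv1 d i g) f := by
  ext t
  rw [convol_eq_convolution, convol_eq_convolution, pderiv1,
    (hgs.hasFDerivAt_convolution_right _ hf hg t).fderiv,
    convolution_precompR_apply _ hf (hgs.fderiv ℝ) (hg.continuous_fderiv one_ne_zero)]
  rfl

lemma continuous_convol {d : ℕ} {g f : EuclideanSpace ℝ (Fin d) → ℝ}
    (hg : Continuous g) (hgs : HasCompactSupport g) (hf : LocallyIntegrable f) :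
    Continuous (convol d g f) := by
  rw [convol_eq_convolution]
  exact hgs.continuous_convolution_right _ hf hg

lemma integrable_convol_integrand {d : ℕ} {g f : EuclideanSpace ℝ (Fin d) → ℝ}
    (hg : Continuous g) (hgs : HasCompactSupport g) (hf : LocallyIntegrable f)
    (t : EuclideanSpace ℝ (Fin d)) : Integrable (fun u => g (t - u) * f u) := by
  have := hgs.convolutionExists_right (ContinuousLinearMap.mul ℝ ℝ) hf hg t
  simpa only [ConvolutionExistsAt, ContinuousLinearMap.mul_apply', mul_comm] using this

lemma convol_assoc {d : ℕ} {A B f : EuclideanSpace ℝ (Fin d) → ℝ}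
    (hA : Continuous A) (hAs : HasCompactSupport A) (hB : Continuous B)
    (hBs : HasCompactSupport B) (hf : LocallyIntegrable f) :
    convol d A (convol d B f) = convol d (convol d A B) f := by
  ext t
  simp only [convol_eq_convolution]
  refine convolution_assoc _ _ _ _ (fun x y z => mul_assoc x y z)
    hf.aestronglyMeasurable hB.aestronglyMeasurable hA.aestronglyMeasurable
    (.of_forall (hBs.convolutionExists_right _ hf hB))
    (.of_forall (hAs.norm.convolutionExists_right _ hB.norm.locallyIntegrable hA.norm)) ?_
  exact (hBs.norm.convolution _ hAs.norm).convolutionExists_right _ (hf.mono hf.aestronglyMeasurable.norm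
    (.of_forall fun _ => (norm_norm _).le))
    (hAs.norm.continuous_convolution_right _ hB.norm.locallyIntegrable hA.norm) t

lemma convol_comm {d : ℕ} (A B : EuclideanSpace ℝ (Fin d) → ℝ) :
    convol d A B = convol d B A := by
  rw [convol_eq_convolution, ← convolution_flip, convol_eq_convolution]
  congr 1
  ext
  simp

/-- The factorization `A * (A * f) - B * (B * f) = (A + B) * (A * f - B * f)`. -/
lemma convol_sq_sub_sq {d : ℕ} {A B f : EuclideanSpace ℝ (Fin d) → ℝ}
    (hA : Continuous A) (hAs : HasCompactSupport A) (hB : Continuous B)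
    (hBs : HasCompactSupport B) (hf : LocallyIntegrable f) :
    (fun t => convol d A (convol d A f) t - convol d B (convol d B f) t) =
      convol d (fun t => A t + B t) (fun t => convol d A f t - convol d B f t) := by
  have hAf := (continuous_convol hA hAs hf).locallyIntegrable (μ := volume)
  have hBf := (continuous_convol hB hBs hf).locallyIntegrable (μ := volume)
  have hAB : convol d A (convol d B f) = convol d B (convol d A f) := by
    rw [convol_assoc hA hAs hB hBs hf, convol_assoc hB hBs hA hAs hf, convol_comm A B]
  ext t
  have e := congrFun hAB t
  have i₁ := integrable_convol_integrand hA hAs hAf t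
  have i₂ := integrable_convol_integrand hA hAs hBf t
  have i₃ := integrable_convol_integrand hB hBs hAf t
  have i₄ := integrable_convol_integrand hB hBs hBf t
  have key : convol d (fun t => A t + B t) (fun t => convol d A f t - convol d B f t) t =
      (convol d A (convol d A f) t - convol d A (convol d B f) t) +
      (convol d B (convol d A f) t - convol d B (convol d B f) t) := by
    rw [convol, convol, convol, convol, convol, ← integral_sub i₁ i₂, ← integral_sub i₃ i₄,
      ← integral_add (by exact i₁.sub i₂) (by exact i₃.sub i₄)]
    congr 1
    ext u
    ring
  rw [key, e]
  ring

/-- Young's inequality `‖g * f‖_∞ ≤ ‖g‖_1 ‖f‖_∞`. -/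
lemma supNorm_convol_le {d : ℕ} (g f : EuclideanSpace ℝ (Fin d) → ℝ) (hg : Integrable g) :
    supNorm d (convol d g f) ≤ ENNReal.ofReal (∫ t, |g t|) * supNorm d f := by
  have hgi : ENNReal.ofReal (∫ t, |g t|) = ∫⁻ t, ‖g t‖ₑ :=
    ofReal_integral_norm_eq_lintegral_enorm hg
  have hm (t) : AEMeasurable (fun u => ‖g (t - u)‖ₑ) :=
    (hg.comp_sub_left t).aestronglyMeasurable.enorm
  rw [hgi, supNorm, supNorm, eLpNorm_exponent_top, eLpNorm_exponent_top]
  refine essSup_le_of_ae_le _ (.of_forall fun t => ?_)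
  calc ‖convol d g f t‖ₑ ≤ ∫⁻ u, ‖g (t - u) * f u‖ₑ := enorm_integral_le_lintegral_enorm _
    _ ≤ ∫⁻ u, ‖g (t - u)‖ₑ * eLpNormEssSup f volume := by
        refine lintegral_mono_ae ?_
        filter_upwards [enorm_ae_le_eLpNormEssSup f volume] with u hu
        rw [enorm_mul]
        gcongr
    _ = (∫⁻ u, ‖g u‖ₑ) * eLpNormEssSup f volume := by
        rw [lintegral_mul_const'' _ (hm t), lintegral_sub_left_eq_self (fun u => ‖g u‖ₑ) t]

lemma integral_abs_resKer (d : ℕ) (g : EuclideanSpace ℝ (Fin d) → ℝ) {h : ℝ} (hh : 0 < h) :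
    ∫ t, |resKer d g h t| = ∫ t, |g t| := by
  have hd : 0 < h ^ d := pow_pos hh d
  simp only [resKer, abs_mul, abs_of_pos (inv_pos.2 hd)]
  rw [integral_const_mul, Measure.integral_comp_inv_smul volume (fun t => |g t|),
    finrank_euclideanSpace_fin, abs_of_pos hd, smul_eq_mul, inv_mul_cancel_left₀ hd.ne']

/-- `∂^α` commutes with convolution and acts on `K_a + K_b` by rescaling `∂^α K`. -/
lemma pderivM_convol_resKer_add {d : ℕ} {K F : EuclideanSpace ℝ (Fin d) → ℝ} {α : Fin d → ℕ}
    (hKs : HasCompactSupport K) (hKc : ContDiff ℝ (∑ i, α i : ℕ) K) (hF : LocallyIntegrable F)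
    {a b : ℝ} (ha : a ≠ 0) (hb : b ≠ 0) :
    Continuous (pderivM d α K) ∧ HasCompactSupport (pderivM d α K) ∧
      pderivM d α (convol d (fun t => resKer d K a t + resKer d K b t) F) =
        convol d (fun t => (a ^ ∑ i, α i)⁻¹ * resKer d (pderivM d α K) a t +
          (b ^ ∑ i, α i)⁻¹ * resKer d (pderivM d α K) b t) F := by
  have key := pderivM_induction d (fun n g G => ContDiff ℝ n g ∧ HasCompactSupport g ∧
      ∃ m, m + n = ∑ i, α i ∧ G = convol d (fun t => (a ^ m)⁻¹ * resKer d g a t +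
          (b ^ m)⁻¹ * resKer d g b t) F) ?_ α K
      (convol d (fun t => resKer d K a t + resKer d K b t) F)
      ⟨hKc, hKs, 0, zero_add _, by simp⟩
  · obtain ⟨h₁, h₂, m, rfl, h₃⟩ := key
    exact ⟨h₁.continuous, h₂, h₃⟩
  · rintro n i g G ⟨hg, hgs, m, hm, rfl⟩
    refine ⟨hg.pderiv1 i, hgs.pderiv1 i, m + 1, by omega, ?_⟩
    have hg1 : ContDiff ℝ (1 : ℕ) g := hg.of_le (by norm_cast; omega)
    have hd (c r : ℝ) : ContDiff ℝ 1 (fun t => c * resKer d g r t) :=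
      contDiff_const.mul (by exact_mod_cast hg1.resKer r)
    have hs (c r : ℝ) (hr : r ≠ 0) : HasCompactSupport (fun t => c * resKer d g r t) :=
      (hgs.resKer hr).mul_left (f := fun _ => c)
    rw [pderiv1_convol i ((hd _ a).add (hd _ b)) ((hs _ a ha).add (hs _ b hb)) hF]
    congr 1
    have hc (c r : ℝ) (t) : fderiv ℝ (fun t => c * resKer d g r t) t (EuclideanSpace.single i 1) =
        c * (r⁻¹ * resKer d (pderiv1 d i g) r t) := by
      rw [← congrFun (pderiv1_resKer d i g r) t]
      change fderiv ℝ (c • resKer d g r) t _ = _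
      rw [fderiv_const_smul_field]
      rfl
    ext t
    rw [pderiv1, fderiv_fun_add ((hd _ a).differentiable one_ne_zero t)
      ((hd _ b).differentiable one_ne_zero t), _root_.add_apply, hc, hc,
      pow_succ, pow_succ, mul_inv, mul_inv]
    ring

/-- Telescoping derivative estimate of the proof of Proposition 3: for `|α| = N`,
`‖∂^α (K_{h'}*(K_{h'}*f) - K_h*(K_h*f))‖_∞ ≤ ((h')^{-N} + h^{-N}) ‖K_{h'}*f - K_h*f‖_∞ ∫|∂^α K|`. -/
theorem telescoping_deriv_bound (d N : ℕ) (hN : 1 ≤ N)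
    (K : EuclideanSpace ℝ (Fin d) → ℝ) (hKs : HasCompactSupport K) (hKc : ContDiff ℝ N K)
    (f : EuclideanSpace ℝ (Fin d) → ℝ) (hf : BddMeas d f)
    (h h' : ℝ) (hh : 0 < h) (hh' : 0 < h')
    (α : Fin d → ℕ) (hα : (∑ i, α i) = N) :
    supNorm d (pderivM d α (fun t =>
        convol d (resKer d K h') (convol d (resKer d K h') f) t -
        convol d (resKer d K h) (convol d (resKer d K h) f) t)) ≤
      ENNReal.ofReal (((h' ^ N)⁻¹ + (h ^ N)⁻¹) * ∫ t, |pderivM d α K t|) *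
        supNorm d (fun t => convol d (resKer d K h') f t - convol d (resKer d K h) f t) := by
  have hfl : LocallyIntegrable f := by
    obtain ⟨hm, M, hM⟩ := hf
    exact (memLp_top_of_bound hm.aestronglyMeasurable M (.of_forall hM)).locallyIntegrable le_top
  have hc (r : ℝ) : Continuous (resKer d K r) := (hKc.resKer r).continuous
  have hs (r : ℝ) (hr : 0 < r) : HasCompactSupport (resKer d K r) := hKs.resKer hr.ne'
  have hF : LocallyIntegrable
      (fun t => convol d (resKer d K h') f t - convol d (resKer d K h) f t) :=
    ((continuous_convol (hc h') (hs h' hh') hfl).sub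
      (continuous_convol (hc h) (hs h hh) hfl)).locallyIntegrable
  subst hα
  obtain ⟨hDc, hDs, hD⟩ := pderivM_convol_resKer_add hKs hKc hF hh'.ne' hh.ne'
  rw [convol_sq_sub_sq (hc h') (hs h' hh') (hc h) (hs h hh) hfl, hD]
  have hi (c r : ℝ) (hr : 0 < r) : Integrable (fun t => c * resKer d (pderivM d α K) r t) := by
    have hrc : Continuous (resKer d (pderivM d α K) r) :=
      (ContDiff.resKer (n := 0) (contDiff_zero.2 hDc) r).continuous
    exact (hrc.integrable_of_hasCompactSupport (hDs.resKer hr.ne')).const_mul c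
  refine (supNorm_convol_le _ _ ((hi _ h' hh').add (hi _ h hh))).trans ?_
  gcongr
  calc _ ≤ ∫ t, (|(h' ^ ∑ i, α i)⁻¹ * resKer d (pderivM d α K) h' t| +
        |(h ^ ∑ i, α i)⁻¹ * resKer d (pderivM d α K) h t|) :=
        integral_mono ((hi _ h' hh').add (hi _ h hh)).abs ((hi _ h' hh').abs.add (hi _ h hh).abs)
          fun t => abs_add_le _ _
    _ = _ := by
        rw [integral_add (hi _ h' hh').abs (hi _ h hh).abs]
        simp only [abs_mul, abs_of_pos (inv_pos.2 (pow_pos hh' _)),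
          abs_of_pos (inv_pos.2 (pow_pos hh _))]
        rw [integral_const_mul, integral_const_mul, integral_abs_resKer _ _ hh',
          integral_abs_resKer _ _ hh]
        ring
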